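/- For every prime n ≥ 3, if G is the Latin-square construction graph, then the list chromatic number of its square satisfies χ_ℓ(G²) > 3(n − 1). -/

import Mathlib

/-- Vertex type of the Latin-square construction graph: `Sum.inl (a, c)` encodes the
vertex `v_{a+1, c+1}` of `P`, and `Sum.inr (i, j)` encodes the vertex `w_{i+1, j+1}` of `Q`
(all indices written 0-indexed via `Fin`/`ZMod`). -/
def LSVertex (n : ℕ) : Type := (Fin n × ZMod n) ⊕ (Fin (n - 1) × ZMod n)

/-- The Latin-square construction graph: the cliques `T_j` consist of the `P`-vertices with a
fixed second coordinate, and `w_{i,j}` is joined to `v_{k, L_i(j,k)}` for every `k`, where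
`L_i(j,k) ≡ j + i(k-1) (mod n)` (all written 0-indexed, so the second coordinate of a
neighbor `v_{k, L_i(j,k)}` of `w_{i,j}` is `(j-1) + i·(k-1)` in `ZMod n`). -/
def latinGraph (n : ℕ) : SimpleGraph (LSVertex n) where
  Adj x y :=
    match x, y with
    | Sum.inl (a, c), Sum.inl (b, c') => c = c' ∧ a ≠ b
    | Sum.inl (k, c), Sum.inr (i, j) => c = j + (((i : ℕ) : ZMod n) + 1) * ((k : ℕ) : ZMod n)
    | Sum.inr (i, j), Sum.inl (k, c) => c = j + (((i : ℕ) : ZMod n) + 1) * ((k : ℕ) : ZMod n)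
    | Sum.inr _, Sum.inr _ => False
  symm := by
    refine ⟨?_⟩
    rintro (⟨a, c⟩ | ⟨i, j⟩) (⟨b, c'⟩ | ⟨i', j'⟩) h
    · exact ⟨h.1.symm, h.2.symm⟩
    · exact h
    · exact h
    · exact h
  loopless := by
    refine ⟨?_⟩
    rintro (⟨a, c⟩ | ⟨i, j⟩) h
    · exact h.2 rfl
    · exact h

/-- The set `P` of all `v`-vertices. -/
def Pall (n : ℕ) : Set (LSVertex n) := {x | ∃ a c, x = Sum.inl (a, c)}

/-- The set `Q` of all `w`-vertices. -/
def Qall (n : ℕ) : Set (LSVertex n) := {x | ∃ i j, x = Sum.inr (i, j)}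

/-- The partite set `P_{a+1} = {v_{a+1,1}, …, v_{a+1,n}}`. -/
def Pset (n : ℕ) (a : Fin n) : Set (LSVertex n) := {x | ∃ c, x = Sum.inl (a, c)}

/-- The clique `T_{c+1} = {v_{1,c+1}, …, v_{n,c+1}}`. -/
def Tset (n : ℕ) (c : ZMod n) : Set (LSVertex n) := {x | ∃ a, x = Sum.inl (a, c)}

/-- The partite set `Q_{i+1} = {w_{i+1,1}, …, w_{i+1,n}}`. -/
def Qset (n : ℕ) (i : Fin (n - 1)) : Set (LSVertex n) := {x | ∃ j, x = Sum.inr (i, j)}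

/-- The square of a graph: two distinct vertices are adjacent iff their distance in `G`
is at most 2, i.e. they are adjacent in `G` or have a common neighbor. -/
def graphSquare {V : Type*} (G : SimpleGraph V) : SimpleGraph V where
  Adj x y := x ≠ y ∧ (G.Adj x y ∨ ∃ z, G.Adj x z ∧ G.Adj z y)
  symm := by
    refine ⟨?_⟩
    rintro x y ⟨hxy, h | ⟨z, h1, h2⟩⟩
    · exact ⟨hxy.symm, Or.inl h.symm⟩
    · exact ⟨hxy.symm, Or.inr ⟨z, h2.symm, h1.symm⟩⟩
  loopless := ⟨fun x h => h.1 rfl⟩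

/-- `G` is `k`-choosable: for any assignment of a list of at least `k` colors to each
vertex, there is a proper coloring choosing each vertex's color from its list. -/
def Choosable {V : Type*} (G : SimpleGraph V) (k : ℕ) : Prop :=
  ∀ L : V → Finset ℕ, (∀ v, k ≤ (L v).card) →
    ∃ φ : V → ℕ, (∀ v, φ v ∈ L v) ∧ ∀ ⦃u w⦄, G.Adj u w → φ u ≠ φ w

/-- The list chromatic number: the least `k` such that `G` is `k`-choosable. -/
noncomputable def listChromaticNumber {V : Type*} (G : SimpleGraph V) : ℕ :=
  sInf {k | Choosable G k}

/-- The chromatic number: the least `k` such that `G` has a proper `k`-coloring. -/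
noncomputable def chromNum {V : Type*} (G : SimpleGraph V) : ℕ :=
  sInf {k | G.Colorable k}

/-- The vertex with index `c` in the partite set `p`. -/
def lsVert (n : ℕ) (p : Fin n ⊕ Fin (n - 1)) (c : ZMod n) : LSVertex n :=
  match p with
  | Sum.inl a => Sum.inl (a, c)
  | Sum.inr i => Sum.inr (i, c)

theorem exists_fin_cast (n : ℕ) [NeZero n] (z : ZMod n) :
    ∃ k : Fin n, ((k : ℕ) : ZMod n) = z :=
  ⟨⟨z.val, z.val_lt⟩, ZMod.natCast_zmod_val z⟩

theorem exists_slope (n : ℕ) [NeZero n] (z : ZMod n) (hz : z ≠ 0) :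
    ∃ i : Fin (n - 1), ((i : ℕ) : ZMod n) + 1 = z := by
  have h1 : z.val ≠ 0 := by
    intro h
    exact hz ((ZMod.val_eq_zero z).1 h)
  have h2 := z.val_lt
  refine ⟨⟨z.val - 1, by omega⟩, ?_⟩
  have h3 : ((z.val - 1 + 1 : ℕ) : ZMod n) = z := by
    rw [Nat.sub_add_cancel (by omega)]
    exact ZMod.natCast_zmod_val z
  push_cast at h3
  exact h3

theorem cast_fin_inj (n a b : ℕ) (ha : a < n) (hb : b < n)
    (h : (a : ZMod n) = (b : ZMod n)) : a = b := by
  have := (ZMod.natCast_eq_natCast_iff' a b n).1 h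
  rwa [Nat.mod_eq_of_lt ha, Nat.mod_eq_of_lt hb] at this

theorem slope_ne_zero (n : ℕ) (i : Fin (n - 1)) : ((i : ℕ) : ZMod n) + 1 ≠ 0 := by
  intro h
  have hi := i.2
  have := cast_fin_inj n (i + 1) 0 (by omega) (by omega) (by push_cast; exact h)
  omega

theorem adj_PQ (n : ℕ) [Fact n.Prime] (a : Fin n) (i : Fin (n - 1)) (c d : ZMod n) :
    (graphSquare (latinGraph n)).Adj (lsVert n (Sum.inl a) c) (lsVert n (Sum.inr i) d) := by
  have hs := slope_ne_zero n i
  refine ⟨fun h => Sum.inl_ne_inr h, ?_⟩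
  obtain ⟨k, hk⟩ := exists_fin_cast n ((c - d) / (((i : ℕ) : ZMod n) + 1))
  have hc : c = d + (((i : ℕ) : ZMod n) + 1) * ((k : ℕ) : ZMod n) := by
    rw [hk]; field_simp; ring
  by_cases hak : a = k
  · subst hak
    left
    exact hc
  · right
    exact ⟨Sum.inl (k, c), ⟨rfl, hak⟩, hc⟩

theorem adj_of_ne (n : ℕ) [Fact n.Prime] (p q : Fin n ⊕ Fin (n - 1)) (c d : ZMod n)
    (hpq : p ≠ q) :
    (graphSquare (latinGraph n)).Adj (lsVert n p c) (lsVert n q d) := by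
  rcases p with a | i <;> rcases q with b | j
  · have hab : a ≠ b := fun h => hpq (by rw [h])
    refine ⟨fun h => hab ?_, ?_⟩
    · exact congrArg Prod.fst (Sum.inl.inj h)
    by_cases hcd : c = d
    · left
      exact ⟨hcd, hab⟩
    · right
      have h1 : ((a : ℕ) : ZMod n) - ((b : ℕ) : ZMod n) ≠ 0 := fun h =>
        hab (Fin.ext (cast_fin_inj n a b a.2 b.2 (sub_eq_zero.1 h)))
      obtain ⟨i, hi⟩ := exists_slope n ((c - d) / (((a : ℕ) : ZMod n) - ((b : ℕ) : ZMod n)))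
        (div_ne_zero (sub_ne_zero.2 hcd) h1)
      refine ⟨Sum.inr (i, c - (((i : ℕ) : ZMod n) + 1) * ((a : ℕ) : ZMod n)), ?_, ?_⟩
      · change c = _ + _
        ring
      · change d = _ + _
        rw [hi]
        field_simp
        ring
  · exact adj_PQ n a j c d
  · exact (adj_PQ n b i d c).symm
  · have hij : i ≠ j := fun h => hpq (by rw [h])
    refine ⟨fun h => hij ?_, ?_⟩
    · exact congrArg Prod.fst (Sum.inr.inj h)
    right
    have h1 : ((j : ℕ) : ZMod n) - ((i : ℕ) : ZMod n) ≠ 0 := fun h =>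
      hij (Fin.ext (cast_fin_inj n i j (by omega) (by omega) (sub_eq_zero.1 h).symm))
    obtain ⟨k, hk⟩ := exists_fin_cast n ((c - d) / (((j : ℕ) : ZMod n) - ((i : ℕ) : ZMod n)))
    refine ⟨Sum.inl (k, c + (((i : ℕ) : ZMod n) + 1) * ((k : ℕ) : ZMod n)), rfl, ?_⟩
    change _ + _ = _ + _
    rw [hk]
    field_simp
    ring

theorem choosable_card {V : Type*} [Fintype V] (G : SimpleGraph V) :
    Choosable G (Fintype.card V) := by
  intro L hL
  obtain ⟨f, hf, hfL⟩ := (Finset.all_card_le_biUnion_card_iff_exists_injective L).1 (by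
    intro s
    rcases s.eq_empty_or_nonempty with rfl | ⟨v, hv⟩
    · simp
    · exact (Finset.card_le_univ s).trans ((hL v).trans
        (Finset.card_le_card (Finset.subset_biUnion_of_mem L hv))))
  exact ⟨f, hfL, fun u w h e => h.ne (hf e)⟩

/-- The index of a vertex inside its partite set. -/
def lsIdx (n : ℕ) (x : LSVertex n) : ℕ :=
  match x with
  | Sum.inl y => y.2.val
  | Sum.inr y => y.2.val

theorem lsIdx_vert (n : ℕ) (p : Fin n ⊕ Fin (n - 1)) (c : ZMod n) :
    lsIdx n (lsVert n p c) = c.val := by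
  cases p <;> rfl

theorem lsIdx_lt (n : ℕ) [NeZero n] (x : LSVertex n) : lsIdx n x < n := by
  cases x <;> exact ZMod.val_lt _

theorem not_choosable (n : ℕ) [Fact n.Prime] (hn : 3 ≤ n) (k : ℕ) (hk : k ≤ 3 * (n - 1)) :
    ¬ Choosable (graphSquare (latinGraph n)) k := by
  intro hch
  obtain ⟨φ, hφ, hadj⟩ := hch
    (fun x => Finset.range (3 * n) \ Finset.Ico (3 * lsIdx n x) (3 * lsIdx n x + 3)) (by
      intro x
      have := lsIdx_lt n x
      rw [Finset.card_sdiff_of_subset]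
      · simp
        omega
      · intro y hy
        simp at hy ⊢
        omega)
  let g : (Fin n ⊕ Fin (n - 1)) → ℕ := fun p => φ (lsVert n p 0)
  let h : (Fin n ⊕ Fin (n - 1)) → ℕ := fun p => φ (lsVert n p ((g p / 3 : ℕ) : ZMod n))
  have hlt : ∀ x, φ x < 3 * n := fun x => by
    have := hφ x
    simp only [Finset.mem_sdiff, Finset.mem_range] at this
    exact this.1
  have hgh : ∀ p, g p ≠ h p := by
    intro p hp
    have h1 := hφ (lsVert n p ((g p / 3 : ℕ) : ZMod n))
    have h2 : g p < 3 * n := hlt _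
    have h3 : (((g p / 3 : ℕ) : ZMod n)).val = g p / 3 := ZMod.val_cast_of_lt (by omega)
    change h p ∈ _ at h1
    rw [lsIdx_vert, h3, ← hp] at h1
    simp only [Finset.mem_sdiff, Finset.mem_range, Finset.mem_Ico] at h1
    omega
  let F : (Fin n ⊕ Fin (n - 1)) ⊕ (Fin n ⊕ Fin (n - 1)) → Fin (3 * n) :=
    Sum.elim (fun p => ⟨g p, hlt _⟩) (fun p => ⟨h p, hlt _⟩)
  have hF : Function.Injective F := by
    rintro (p | p) (q | q) e <;> have e' := congrArg Fin.val e <;>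
      by_cases hpq : p = q
    · rw [hpq]
    · exact absurd e' (hadj (adj_of_ne n p q _ _ hpq))
    · subst hpq; exact absurd e' (hgh p)
    · exact absurd e' (hadj (adj_of_ne n p q _ _ hpq))
    · subst hpq; exact absurd e'.symm (hgh p)
    · exact absurd e' (hadj (adj_of_ne n p q _ _ hpq))
    · rw [hpq]
    · exact absurd e' (hadj (adj_of_ne n p q _ _ hpq))
  have := Fintype.card_le_of_injective F hF
  simp at this
  omega

/-- For every prime `n ≥ 3`, the square of the Latin-square construction graph has list
chromatic number greater than `3(n - 1)`. -/
theorem listChromatic_square_latinGraph_gt (n : ℕ) (hp : n.Prime) (hn : 3 ≤ n) :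
    3 * (n - 1) < listChromaticNumber (graphSquare (latinGraph n)) := by
  have : Fact n.Prime := ⟨hp⟩
  have : Fintype (LSVertex n) :=
    inferInstanceAs (Fintype ((Fin n × ZMod n) ⊕ (Fin (n - 1) × ZMod n)))
  by_contra hcon
  exact not_choosable n hn _ (not_lt.1 hcon)
    (Nat.sInf_mem (s := {k | Choosable (graphSquare (latinGraph n)) k}) ⟨_, choosable_card _⟩)
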